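/- For each i ≥ −1, #N_i(2i+3) > 0; that is, there exists a maximal chain of length 3i+3 in the Tamari lattice T_{2i+3} having no plus-full-sets. -/

import Mathlib

/-!
Common definitions for formalizing "A recursion on maximal chains in the Tamari lattices"
(L. Nelson).

* Young diagrams are encoded by their row-length functions `lam : ℕ → ℕ` (rows indexed from 1,
  with `lam 0 = 0`).
* Dyck paths are lists of steps (north/east).
* Tableaux are encoded by entry functions `f : ℕ × ℕ → ℕ` (1-indexed boxes; value `0` means
  "no box").  The label of box `(x, y)` is `f (x, y)`.
-/

noncomputable section

namespace TamariMaxChains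

/-- A step of a lattice path: north or east. -/
inductive Step : Type
  | N : Step
  | E : Step
deriving DecidableEq

/-- Number of north steps of a path. -/
def nCount (p : List Step) : ℕ := p.count Step.N

/-- Number of east steps of a path. -/
def eCount (p : List Step) : ℕ := p.count Step.E

/-- `p` is a Dyck path: equally many norths and easts, and every prefix has at least as many
north steps as east steps (the path never goes below the diagonal `y = x`). -/
def IsDyck (p : List Step) : Prop :=
  nCount p = eCount p ∧ ∀ q : List Step, q <+: p → eCount q ≤ nCount q

/-- `q` is a prime Dyck path: it meets the slope-one line joining its endpoints only at its
endpoints. -/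
def IsPrimeDyck (q : List Step) : Prop :=
  q ≠ [] ∧ nCount q = eCount q ∧
    ∀ s : List Step, s <+: q → s ≠ [] → s ≠ q → eCount s < nCount s

/-- Covering relation of the Tamari lattice on Dyck paths:  `TamariCoverD P' P` means `P'`
covers `P`, i.e. `P'` is obtained from `P` by swapping an east step that is followed by a north
step with the prime Dyck subpath following it. -/
def TamariCoverD (P' P : List Step) : Prop :=
  ∃ a q b : List Step, IsPrimeDyck q ∧
    P = a ++ Step.E :: (q ++ b) ∧ P' = a ++ (q ++ Step.E :: b)

/-- `lam` is the row-length function of a Young diagram: rows are indexed from `1`,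
`lam x` is the number of boxes in row `x`, rows weakly decrease, finitely many boxes. -/
def IsDiagram (lam : ℕ → ℕ) : Prop :=
  lam 0 = 0 ∧ (∀ x, 1 ≤ x → lam (x + 1) ≤ lam x) ∧ ∃ N, ∀ x, N ≤ x → lam x = 0

/-- The height (number of north steps) of the prime path of row `d ≥ 1` of the Young diagram
with row lengths `lam`:  the least `t ≥ 1` such that either `t = d` (row `0` being regarded as
an infinite row of boxes) or row `d - t` has length at least `lam d + t`. -/
def primeHeight (lam : ℕ → ℕ) (d : ℕ) : ℕ :=
  sInf {t | 1 ≤ t ∧ (t = d ∨ (t < d ∧ lam d + t ≤ lam (d - t)))}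

/-- The last box of row `d` is a corner box (last box of its row and lowest box of
its column). -/
def IsCorner (lam : ℕ → ℕ) (d : ℕ) : Prop := 1 ≤ d ∧ 1 ≤ lam d ∧ lam (d + 1) < lam d

/-- The result of removing the `B`-strip of the last box `B` of row `d`: the last box of each of
the rows `d - h + 1, …, d` is removed, where `h` is the height of the prime path of row `d`. -/
def removeStrip (lam : ℕ → ℕ) (d : ℕ) : ℕ → ℕ := fun x =>
  if d + 1 ≤ x + primeHeight lam d ∧ x ≤ d then lam x - 1 else lam x

/-- Covering relation of the Tamari lattice on Young diagrams:  `mu` covers `lam` iff `mu` is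
obtained from `lam` by removing the `B`-strip of a corner box `B`. -/
def TamariCoverY (mu lam : ℕ → ℕ) : Prop := ∃ d, IsCorner lam d ∧ mu = removeStrip lam d

/-- The `B`-strip of the last box `B` of row `d`: the set of last boxes of rows
`d - h + 1, …, d`, where `h` is the height of the prime path of row `d`. -/
def stripSet (lam : ℕ → ℕ) (d : ℕ) : Set (ℕ × ℕ) :=
  {b | b.2 = lam b.1 ∧ 1 ≤ b.2 ∧ d + 1 ≤ b.1 + primeHeight lam d ∧ b.1 ≤ d}

/-- The enclosure of the `B`-strip of the last box `B = (d, lam d)` of row `d`: all boxes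
`(x, y)` with `d - h ≤ x ≤ d` and `lam d ≤ y ≤ lam d + h`, where row `0` is regarded as an
infinite row of boxes. -/
def enclosure (lam : ℕ → ℕ) (d : ℕ) : Set (ℕ × ℕ) :=
  {b | (b.1 = 0 ∨ b.2 ≤ lam b.1) ∧ 1 ≤ b.2 ∧
    d ≤ b.1 + primeHeight lam d ∧ b.1 ≤ d ∧ lam d ≤ b.2 ∧ b.2 ≤ lam d + primeHeight lam d}

/-- The Dyck path of length `2 n` corresponding to the Young diagram `lam` contained in the
staircase `δ_{n-1}` (the Dyck path is the silhouette of the Young diagram). -/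
def toDyck (n : ℕ) (lam : ℕ → ℕ) : List Step :=
  ((List.range n).flatMap fun k =>
    List.replicate (lam (n - k) - lam (n - k + 1)) Step.E ++ [Step.N]) ++
    List.replicate (n - lam 1) Step.E

/-- The prime path of row `d` of the Young diagram `lam`, as its list of steps (read from its
lower-left endpoint). -/
def primePathList (lam : ℕ → ℕ) (d : ℕ) : List Step :=
  Step.N :: ((((List.range (primeHeight lam d - 1)).flatMap fun j =>
    List.replicate (lam (d - 1 - j) - lam (d - j)) Step.E ++ [Step.N])) ++
    List.replicate (lam d + primeHeight lam d - lam (d - (primeHeight lam d - 1))) Step.E)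

/-- `S` translates to `S'` by `p` units down and `q` units to the right. -/
def TranslatesBy (p q : ℤ) (S S' : Set (ℕ × ℕ)) : Prop :=
  ∀ x y : ℕ, (x, y) ∈ S' ↔ ∃ a b : ℕ, (a, b) ∈ S ∧ (x : ℤ) = a + p ∧ (y : ℤ) = b + q

/-- `S` translates to `S'`. -/
def Translates (S S' : Set (ℕ × ℕ)) : Prop := ∃ p q : ℤ, TranslatesBy p q S S'

/-- The length of a tableau: its number of distinct labels (for an honest tableau, labels are
exactly `1, …, tlen f`). -/
def tlen (f : ℕ × ℕ → ℕ) : ℕ := sSup {v | v ≠ 0 ∧ ∃ b, f b = v}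

/-- The number of boxes in row `x` of a tableau. -/
def rowLen (f : ℕ × ℕ → ℕ) (x : ℕ) : ℕ := sSup {y | f (x, y) ≠ 0}

/-- The number of boxes in column `y` of a tableau. -/
def colLen (f : ℕ × ℕ → ℕ) (y : ℕ) : ℕ := sSup {x | f (x, y) ≠ 0}

/-- `f` is (the entry function of) a tableau: the support is a Young diagram (1-indexed),
rows strictly increase, columns weakly increase, and the set of labels is exactly
`{1, …, tlen f}`. -/
def IsTableau (f : ℕ × ℕ → ℕ) : Prop :=
  (∀ y, f (0, y) = 0) ∧ (∀ x, f (x, 0) = 0) ∧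
  {b : ℕ × ℕ | f b ≠ 0}.Finite ∧
  (∀ x y x' y', 1 ≤ x' → x' ≤ x → 1 ≤ y' → y' ≤ y → f (x, y) ≠ 0 → f (x', y') ≠ 0) ∧
  (∀ x y, f (x, y) ≠ 0 → f (x, y + 1) ≠ 0 → f (x, y) < f (x, y + 1)) ∧
  (∀ x y, f (x, y) ≠ 0 → f (x + 1, y) ≠ 0 → f (x, y) ≤ f (x + 1, y)) ∧
  (∀ v, 1 ≤ v → (v ≤ tlen f ↔ ∃ b, f b = v))

/-- `T^(r)`: the subtableau of all entries at most `r`. -/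
def trunc (f : ℕ × ℕ → ℕ) (r : ℕ) : ℕ × ℕ → ℕ := fun b => if f b ≤ r then f b else 0

/-- The shape (row-length function) of a tableau. -/
def shapeOf (f : ℕ × ℕ → ℕ) : ℕ → ℕ := fun x => rowLen f x

/-- The row index of the end-box of the `k`-set of `f` (the maximal row index of a box
labeled `k`). -/
def endRow (f : ℕ × ℕ → ℕ) (k : ℕ) : ℕ := sSup {x | ∃ y, f (x, y) = k}

/-- `Y 0 ⋗ Y 1 ⋗ ⋯ ⋗ Y l` is a saturated chain in the Tamari order on Young diagrams whose
maximal element `Y 0` is the empty diagram (each `Y r` covers `Y (r+1)`). -/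
def IsTamariChain (Y : ℕ → ℕ → ℕ) (l : ℕ) : Prop :=
  (∀ r, r ≤ l → IsDiagram (Y r)) ∧ (∀ x, Y 0 x = 0) ∧
    ∀ r, r < l → TamariCoverY (Y r) (Y (r + 1))

/-- The tableau `ψ(C)` of the saturated chain `C = (∅ = Y 0 ⋗ ⋯ ⋗ Y l)`: the boxes removed in
the transition `Y (r-1) ⋗ Y r` are labeled `r`; that is, each box of `Y l` is labeled by the
least `r` such that the box belongs to `Y r`. -/
def psiFun (Y : ℕ → ℕ → ℕ) (l : ℕ) : ℕ × ℕ → ℕ := fun b =>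
  if 1 ≤ b.1 ∧ 1 ≤ b.2 ∧ b.2 ≤ Y l b.1 then sInf {r | r ≤ l ∧ b.2 ≤ Y r b.1} else 0

/-- `f` is a `ψ`-tableau: it is in the image of `ψ`. -/
def IsPsiTab (f : ℕ × ℕ → ℕ) : Prop :=
  ∃ l Y, IsTamariChain Y l ∧ f = psiFun Y l

/-- Row lengths of the staircase shape `δ_{n-1} = (n-1, n-2, …, 1)`: row `x ≥ 1` has `n - x`
boxes. -/
def dstair (n : ℕ) : ℕ → ℕ := fun x => if x = 0 then 0 else n - x

/-- `C_i(n)`, via `ψ`: the set of maximal chains of length `n + i` in the Tamari lattice `T_n`,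
identified with the `ψ`-tableaux of length `n + i` and shape `δ_{n-1}`. -/
def MemC (i : ℤ) (n : ℕ) (f : ℕ × ℕ → ℕ) : Prop :=
  IsTableau f ∧ IsPsiTab f ∧ (∀ x, rowLen f x = dstair n x) ∧ (tlen f : ℤ) = (n : ℤ) + i

/-- The `r`-set of `f` (of shape `δ_{n-1}`) is a full-set with end-box `(k, n - k)`:
it begins in row `1` and ends in the outer diagonal, at the box `(k, n - k)`. -/
def HasFullSetAt (f : ℕ × ℕ → ℕ) (n r k : ℕ) : Prop :=
  (∃ y, f (1, y) = r) ∧ 1 ≤ k ∧ k ≤ n - 1 ∧ f (k, n - k) = r ∧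
    ∀ x y, f (x, y) = r → x ≤ k

/-- `f` has an `r`-full-set. -/
def HasFullSet (f : ℕ × ℕ → ℕ) (n r : ℕ) : Prop := ∃ k, HasFullSetAt f n r k

/-- `f` has an `r⁺`-full-set (plus-full-set): an `r`-full-set whose end-box `(k, n-k)` satisfies
`k = n - 1`, or `k ≤ n - 2` and the southwest neighbor has a smaller label. -/
def HasPlusFullSet (f : ℕ × ℕ → ℕ) (n r : ℕ) : Prop :=
  ∃ k, HasFullSetAt f n r k ∧ (k = n - 1 ∨ (k ≤ n - 2 ∧ f (k + 1, n - k - 1) < r))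

/-- `F_i^r(n)`: the set of `C ∈ C_i(n)` whose `r`-set is a plus-full-set and whose `j`-set is
not a plus-full-set for any `j ∈ [r-1]`. -/
def MemF (i : ℤ) (n : ℕ) (r : ℕ) (f : ℕ × ℕ → ℕ) : Prop :=
  MemC i n f ∧ HasPlusFullSet f n r ∧ ∀ j, 1 ≤ j → j < r → ¬ HasPlusFullSet f n j

/-- `N_i(n)`: the set of `C ∈ C_i(n)` having no plus-full-sets. -/
def MemN (i : ℤ) (n : ℕ) (f : ℕ × ℕ → ℕ) : Prop :=
  MemC i n f ∧ ∀ r, ¬ HasPlusFullSet f n r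

/-- `α_d`: shift all rows of index greater than `d` down one row and repeat row `d` in
row `d + 1`. -/
def alphaFun (d : ℕ) (f : ℕ × ℕ → ℕ) : ℕ × ℕ → ℕ := fun b =>
  if b.1 ≤ d then f b else f (b.1 - 1, b.2)

/-- `β_d`: append a box labeled `tlen f + 1` at the end of each of the rows `1, …, d`. -/
def betaFun (d : ℕ) (f : ℕ × ℕ → ℕ) : ℕ × ℕ → ℕ := fun b =>
  if 1 ≤ b.1 ∧ b.1 ≤ d ∧ b.2 = rowLen f b.1 + 1 then tlen f + 1 else f b

/-- The number of boxes of row `x` of `f` whose label is at most `r` (these occupy an initial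
segment of the row). -/
def lowLen (f : ℕ × ℕ → ℕ) (r x : ℕ) : ℕ := sSup {y | f (x, y) ≠ 0 ∧ f (x, y) ≤ r}

/-- The row index `d` used in the definition of `Ĉ(r)`: the minimal `k ∈ [n-1]` with
`C (k, n-k) ≤ r` if such `k` exists, and `n` otherwise. -/
def hatD (f : ℕ × ℕ → ℕ) (n r : ℕ) : ℕ :=
  sInf ({k | 1 ≤ k ∧ k ≤ n - 1 ∧ 1 ≤ f (k, n - k) ∧ f (k, n - k) ≤ r} ∪ {n})

/-- `Ĉ(r)` for `C ∈ C_i(n)` and `0 ≤ r ≤ n + i`: starting from `β_d(α_d(C^(r)))` (where `d` is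
as in `hatD`), the entries of `C` greater than `r` of row index less than `d` are translated one
unit to the right, those of row index greater than `d` are translated one unit down, and all
these labels are incremented by one. -/
def hatFun (f : ℕ × ℕ → ℕ) (n r : ℕ) : ℕ × ℕ → ℕ := fun b =>
  let d := hatD f n r
  let x := b.1
  let y := b.2
  if x = 0 ∨ y = 0 then 0
  else if x ≤ d then
    if f (x, y) ≠ 0 ∧ f (x, y) ≤ r then f (x, y)
    else if y = lowLen f r x + 1 then r + 1
    else if r < f (x, y - 1) then f (x, y - 1) + 1
    else 0
  else if x = d + 1 then f (d, y)
  else if f (x - 1, y) = 0 then 0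
  else if f (x - 1, y) ≤ r then f (x - 1, y)
  else f (x - 1, y) + 1

/-- `RepBy i m t r C0 C` : `C = (φ_{i,m+t-1}^{r 1} ∘ φ_{i,m+t-2}^{r 2} ∘ ⋯ ∘ φ_{i,m}^{r t}) C0`,
each factor being applied within its domain. -/
def RepBy (i : ℤ) (m t : ℕ) (r : ℕ → ℕ) (C0 C : ℕ × ℕ → ℕ) : Prop :=
  ∃ D : ℕ → ℕ × ℕ → ℕ, D 0 = C0 ∧ D t = C ∧
    ∀ s, s < t →
      MemC i (m + s) (D s) ∧
      ((r (t - s) : ℤ) ≤ (m : ℤ) + s + i) ∧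
      (∀ j, 1 ≤ j → j ≤ r (t - s) → ¬ HasPlusFullSet (D s) (m + s) j) ∧
      D (s + 1) = hatFun (D s) (m + s) (r (t - s))

/-- The set `𝕏_{d,n-1}^r` of Theorem 4.3: `ψ`-tableaux of length `r`, contained in `δ_{n-1}`,
whose row `d` has length `n - d` and whose prime path of row `d` has height `d`. -/
def MemX (d n r : ℕ) (f : ℕ × ℕ → ℕ) : Prop :=
  IsTableau f ∧ IsPsiTab f ∧ tlen f = r ∧
    (∀ x, 1 ≤ x → rowLen f x ≤ n - x) ∧
    rowLen f d = n - d ∧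
    primeHeight (shapeOf f) d = d

/-- The set `ℤ_{d,n}^{r+1}` of Theorem 4.3: `ψ`-tableaux of length `r + 1`, contained in `δ_n`,
such that rows `d` and `d+1` of the truncation at `r` are identical, the end-box of the
`(r+1)`-set is `(d, n-d+1)`, and the prime path of `(d, n-d+1)` has height `d`. -/
def MemZ (d n r : ℕ) (g : ℕ × ℕ → ℕ) : Prop :=
  IsTableau g ∧ IsPsiTab g ∧ tlen g = r + 1 ∧
    (∀ x, 1 ≤ x → rowLen g x ≤ n + 1 - x) ∧
    (∀ y, trunc g r (d, y) = trunc g r (d + 1, y)) ∧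
    g (d, n - d + 1) = r + 1 ∧ (∀ x y, g (x, y) = r + 1 → x ≤ d) ∧
    primeHeight (shapeOf g) d = d

/-- The explicit chain: row lengths of the `r`-th diagram. -/
def exY (m r : ℕ) : ℕ → ℕ := fun x =>
  if x = 0 then 0 else if x + 2 * (r / 3) + 1 ≤ 2 * m then 2 * (r / 3) + r % 3
  else min (2 * (r / 3)) (2 * m + 1 - x)

/-- The explicit tableau. -/
def exF (m : ℕ) : ℕ × ℕ → ℕ := fun b =>
  if 1 ≤ b.1 ∧ 1 ≤ b.2 ∧ b.1 + b.2 ≤ 2 * m + 1 then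
    (if b.2 % 2 = 0 then 3 * (b.2 / 2) - 1
     else if b.1 + b.2 = 2 * m + 1 then 3 * (b.2 / 2) + 3 else 3 * (b.2 / 2) + 1)
  else 0

theorem exF_eq_psi (m : ℕ) : exF m = psiFun (exY m) (3 * m) := by
  funext ⟨x, y⟩
  have hY : exY m (3 * m) x = if x = 0 then 0 else min (2 * m) (2 * m + 1 - x) := by
    have h1 : 3 * m / 3 = m := by omega
    unfold exY
    rw [h1]
    split_ifs <;> omega
  simp only [exF, psiFun, hY]
  by_cases h : 1 ≤ x ∧ 1 ≤ y ∧ x + y ≤ 2 * m + 1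
  · have h' : 1 ≤ x ∧ 1 ≤ y ∧ y ≤ if x = 0 then 0 else min (2 * m) (2 * m + 1 - x) := by
      split_ifs <;> omega
    rw [if_pos h, if_pos h']
    symm
    apply IsLeast.csInf_eq
    constructor
    · simp only [Set.mem_ofPred_eq, exY]
      constructor
      · split_ifs <;> omega
      · split_ifs <;> omega
    · rintro r ⟨hr, hy⟩
      simp only [exY] at hy
      split_ifs at hy ⊢ <;> omega
  · have h' : ¬ (1 ≤ x ∧ 1 ≤ y ∧ y ≤ if x = 0 then 0 else min (2 * m) (2 * m + 1 - x)) := by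
      split_ifs <;> omega
    rw [if_neg h, if_neg h']

theorem exY_diagram (m r : ℕ) (hr : r ≤ 3 * m) : IsDiagram (exY m r) := by
  refine ⟨by simp [exY], ?_, 2 * m + 1, ?_⟩
  · intro x hx
    simp only [exY]
    split_ifs <;> omega
  · intro x hx
    simp only [exY]
    split_ifs <;> omega

theorem exY_cover (m r : ℕ) (hr : r < 3 * m) : TamariCoverY (exY m r) (exY m (r + 1)) := by
  by_cases hc : r % 3 = 2
  · obtain ⟨q, rfl⟩ : ∃ q, r = 3 * q + 2 := ⟨r / 3, by omega⟩
    have e1 : (3 * q + 2) / 3 = q := by omega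
    have e2 : (3 * q + 2 + 1) / 3 = q + 1 := by omega
    have e3 : (3 * q + 2) % 3 = 2 := by omega
    have e4 : (3 * q + 2 + 1) % 3 = 0 := by omega
    have hp : primeHeight (exY m (3 * q + 2 + 1)) (2 * m - 2 * q) = 1 := by
      apply IsLeast.csInf_eq
      constructor
      · refine ⟨le_rfl, Or.inr ⟨by omega, ?_⟩⟩
        simp only [exY, e2, e4]
        split_ifs <;> omega
      · rintro t ⟨ht, _⟩
        exact ht
    refine ⟨2 * m - 2 * q, ⟨by omega, ?_, ?_⟩, ?_⟩
    · simp only [exY, e2, e4]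
      split_ifs <;> omega
    · simp only [exY, e2, e4]
      split_ifs <;> omega
    · funext x
      simp only [removeStrip, hp, exY, e1, e2, e3, e4]
      split_ifs <;> omega
  · obtain ⟨q, c, rfl, hc⟩ : ∃ q c, r = 3 * q + c ∧ c < 2 := ⟨r / 3, r % 3, by omega, by omega⟩
    have e1 : (3 * q + c) / 3 = q := by omega
    have e2 : (3 * q + c + 1) / 3 = q := by omega
    have e3 : (3 * q + c) % 3 = c := by omega
    have e4 : (3 * q + c + 1) % 3 = c + 1 := by omega
    have hp : primeHeight (exY m (3 * q + c + 1)) (2 * m - 2 * q - 1) = 2 * m - 2 * q - 1 := by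
      apply IsLeast.csInf_eq
      constructor
      · exact ⟨by omega, Or.inl rfl⟩
      · rintro t ⟨ht, ht' | ⟨h1, h2⟩⟩
        · omega
        · exfalso
          simp only [exY, e2, e4] at h2
          split_ifs at h2 <;> omega
    refine ⟨2 * m - 2 * q - 1, ⟨by omega, ?_, ?_⟩, ?_⟩
    · simp only [exY, e2, e4]
      split_ifs <;> omega
    · simp only [exY, e2, e4]
      split_ifs <;> omega
    · funext x
      simp only [removeStrip, hp, exY, e1, e2, e3, e4]
      split_ifs <;> omega

theorem exF_ne_zero (m x y : ℕ) :
    exF m (x, y) ≠ 0 ↔ 1 ≤ x ∧ 1 ≤ y ∧ x + y ≤ 2 * m + 1 := by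
  simp only [exF]
  split_ifs <;> omega

theorem exF_surj (m v : ℕ) (h1 : 1 ≤ v) (h2 : v ≤ 3 * m) : ∃ b, exF m b = v := by
  have : v % 3 = 0 ∨ v % 3 = 1 ∨ v % 3 = 2 := by omega
  rcases this with h | h | h
  · refine ⟨(2 * m + 2 - 2 * (v / 3), 2 * (v / 3) - 1), ?_⟩
    simp only [exF]
    split_ifs <;> omega
  · refine ⟨(1, 2 * (v / 3) + 1), ?_⟩
    simp only [exF]
    split_ifs <;> omega
  · refine ⟨(1, 2 * (v / 3) + 2), ?_⟩
    simp only [exF]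
    split_ifs <;> omega

theorem exF_le (m : ℕ) (b : ℕ × ℕ) : exF m b ≤ 3 * m := by
  simp only [exF]
  split_ifs <;> omega

theorem exF_tlen (m : ℕ) : tlen (exF m) = 3 * m := by
  rcases Nat.eq_zero_or_pos m with rfl | hm
  · have : {v | v ≠ 0 ∧ ∃ b, exF 0 b = v} = ∅ := by
      ext v
      simp only [Set.mem_ofPred_eq, Set.mem_empty_iff_false, iff_false]
      rintro ⟨hv, b, hb⟩
      have := exF_le 0 b
      omega
    rw [tlen, this]
    simp
  · apply IsGreatest.csSup_eq
    refine ⟨⟨by omega, exF_surj m _ (by omega) le_rfl⟩, ?_⟩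
    rintro v ⟨_, b, rfl⟩
    exact exF_le m b

theorem exF_rowLen (m x : ℕ) : rowLen (exF m) x = dstair (2 * m + 1) x := by
  simp only [rowLen, exF_ne_zero, dstair]
  by_cases h : 1 ≤ x ∧ x ≤ 2 * m
  · apply IsGreatest.csSup_eq
    rw [if_neg (by omega)]
    refine ⟨⟨by omega, by omega, by omega⟩, ?_⟩
    rintro y ⟨h1, h2, h3⟩
    omega
  · have : {y | 1 ≤ x ∧ 1 ≤ y ∧ x + y ≤ 2 * m + 1} = ∅ := by
      ext v
      simp only [Set.mem_ofPred_eq, Set.mem_empty_iff_false, iff_false]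
      omega
    rw [this]
    simp only [csSup_empty, Nat.bot_eq_zero]
    split_ifs <;> omega

theorem exF_tableau (m : ℕ) : IsTableau (exF m) := by
  refine ⟨by simp [exF], by simp [exF], ?_, ?_, ?_, ?_, ?_⟩
  · apply ((Set.finite_Iic (2 * m + 1)).prod (Set.finite_Iic (2 * m + 1))).subset
    rintro ⟨x, y⟩ h
    have := (exF_ne_zero m x y).1 h
    simp only [Set.mem_prod, Set.mem_Iic]
    omega
  · intro x y x' y' h1 h2 h3 h4 h
    rw [exF_ne_zero] at h ⊢
    omega
  · intro x y h1 h2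
    rw [exF_ne_zero] at h1 h2
    simp only [exF]
    split_ifs <;> omega
  · intro x y h1 h2
    rw [exF_ne_zero] at h1 h2
    simp only [exF]
    split_ifs <;> omega
  · intro v hv
    rw [exF_tlen]
    exact ⟨exF_surj m v hv, by rintro ⟨b, rfl⟩; exact exF_le m b⟩

theorem exF_memN (m : ℕ) : MemN ((m : ℤ) - 1) (2 * m + 1) (exF m) := by
  refine ⟨⟨exF_tableau m, ⟨3 * m, exY m, ⟨exY_diagram m, ?_, exY_cover m⟩, exF_eq_psi m⟩,
    exF_rowLen m, ?_⟩, ?_⟩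
  · intro x
    simp [exY]
  · rw [exF_tlen]
    push_cast
    ring
  · rintro r ⟨k, ⟨⟨y, hy⟩, hk1, hk2, hk, _⟩, h⟩
    by_cases hkp : k % 2 = 0
    · -- the label of the end-box is a multiple of three, so not in row one
      have hr : r % 3 = 0 ∧ 1 ≤ r := by
        rw [← hk]
        simp only [exF]
        split_ifs <;> omega
      rw [← hy] at hr
      simp only [exF] at hr
      split_ifs at hr <;> omega
    · rcases h with h | ⟨h1, h2⟩
      · omega
      · rw [← hk] at h2
        simp only [exF] at h2
        split_ifs at h2 <;> omega

theorem memC_finite (i : ℤ) (n : ℕ) : {C : ℕ × ℕ → ℕ | MemC i n C}.Finite := by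
  have key : ∀ C, MemC i n C → (∀ b, C b < (n + i).toNat + 1) ∧
      ∀ x y, C (x, y) ≠ 0 → x < n + 1 ∧ y < n + 1 := by
    rintro C ⟨⟨h0, h0', hfin, _, _, _, hlab⟩, _, hrow, hlen⟩
    constructor
    · intro b
      by_cases hb : C b = 0
      · omega
      · have := (hlab (C b) (by omega)).2 ⟨b, rfl⟩
        omega
    · intro x y hxy
      have hbd : BddAbove {y | C (x, y) ≠ 0} := by
        apply Set.Finite.bddAbove
        exact (hfin.image Prod.snd).subset (fun y hy => ⟨(x, y), hy, rfl⟩)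
      have h1 : y ≤ rowLen C x := le_csSup hbd hxy
      rw [hrow] at h1
      have hx : x ≠ 0 := by
        rintro rfl
        exact hxy (h0 y)
      have hy : y ≠ 0 := by
        rintro rfl
        exact hxy (h0' x)
      simp only [dstair, if_neg hx] at h1
      omega
  refine Set.Finite.of_injOn (t := (Set.univ : Set (Fin (n + 1) → Fin (n + 1) →
      Fin ((n + i).toNat + 1))))
    (f := fun C a b => Fin.ofNat ((n + i).toNat + 1) (C (a.1, b.1)))
    (fun _ _ => Set.mem_univ _) ?_ Set.finite_univ
  intro C hC D hD hCD
  obtain ⟨c1, c2⟩ := key C hC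
  obtain ⟨d1, d2⟩ := key D hD
  funext ⟨x, y⟩
  by_cases hb : x < n + 1 ∧ y < n + 1
  · have := congrArg Fin.val (congrFun (congrFun hCD ⟨x, hb.1⟩) ⟨y, hb.2⟩)
    simp only [Fin.ofNat] at this
    rwa [Nat.mod_eq_of_lt (c1 _), Nat.mod_eq_of_lt (d1 _)] at this
  · have hc : C (x, y) = 0 := by
      by_contra h
      exact hb (c2 x y h)
    have hd : D (x, y) = 0 := by
      by_contra h
      exact hb (d2 x y h)
    rw [hc, hd]

/-- **Lemma 5.4.**  For each `i ≥ -1`, `#N_i(2i+3) > 0`: there is a maximal chain of length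
`3i + 3` in the Tamari lattice `T_{2i+3}` having no plus-full-sets. -/
theorem exists_chain_no_pfs (i : ℤ) (hi : -1 ≤ i) :
    0 < Set.ncard {C : ℕ × ℕ → ℕ | MemN i (2 * i + 3).toNat C} := by
  obtain ⟨m, hm⟩ : ∃ m : ℕ, (m : ℤ) = i + 1 := ⟨(i + 1).toNat, by omega⟩
  have hi' : i = (m : ℤ) - 1 := by omega
  have hn : (2 * i + 3).toNat = 2 * m + 1 := by omega
  rw [hn, hi', Set.ncard_pos ((memC_finite _ _).subset fun C hC => hC.1)]
  exact ⟨exF m, exF_memN m⟩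

end TamariMaxChains
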